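/- Original (linear) Morawetz identity for NLS in convolution form (A3.2): let h : ℝⁿ → ℝ be a smooth even function all of whose derivatives of order ≥ 1 are bounded, and let u be a smooth decaying solution of the NLS equation. Define M₀(t,x) = -(∇h ⋆ j(t))(x) = -Σ_k (∂_k h ⋆ j_k(t))(x). Then for all (t,x): ∂_t M₀ = Σ_{k,l=1}^n ( ∂_k∂_l h ⋆ Re(∂_k ū ∂_l u) )(t,x) + ( Δh ⋆ ( -(1/4)Δρ + ρ g(ρ) - G(ρ) ) )(t,x). -/

import Mathlib

open MeasureTheory Filter Complex

noncomputable section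

/-- `ℝⁿ` as a Euclidean space. -/
abbrev Ed (n : ℕ) := EuclideanSpace ℝ (Fin n)

/-- Spatial partial derivative `∂_k` of a complex-valued function. -/
def pd {n : ℕ} (k : Fin n) (f : Ed n → ℂ) (x : Ed n) : ℂ :=
  fderiv ℝ f x (EuclideanSpace.single k 1)

/-- Spatial partial derivative `∂_k` of a real-valued function. -/
def pdR {n : ℕ} (k : Fin n) (f : Ed n → ℝ) (x : Ed n) : ℝ :=
  fderiv ℝ f x (EuclideanSpace.single k 1)

/-- Spatial Laplacian of a complex-valued function. -/
def lapC {n : ℕ} (f : Ed n → ℂ) (x : Ed n) : ℂ := ∑ k, pd k (fun y => pd k f y) x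

/-- Spatial Laplacian of a real-valued function. -/
def lapR {n : ℕ} (f : Ed n → ℝ) (x : Ed n) : ℝ := ∑ k, pdR k (fun y => pdR k f y) x

/-- Second partial derivative `∂_k ∂_l h`. -/
def hess {n : ℕ} (h : Ed n → ℝ) (k l : Fin n) (x : Ed n) : ℝ :=
  pdR k (fun y => pdR l h y) x

/-- `u(t,·)` and all its space-time derivatives are Schwartz in `x`,
uniformly for `t` in compact intervals. -/
def SchwartzDecay {n : ℕ} (u : ℝ → Ed n → ℂ) : Prop :=
  ∀ (N m : ℕ) (a b : ℝ), ∃ C : ℝ, ∀ t ∈ Set.Icc a b, ∀ x : Ed n,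
    (1 + ‖x‖) ^ m * ‖iteratedFDeriv ℝ N (fun p : ℝ × Ed n => u p.1 p.2) (t, x)‖ ≤ C

/-- A smooth decaying solution of the NLS equation `i ∂_t u = -(1/2) Δu + g(|u|²) u`. -/
def IsNLSSolution {n : ℕ} (g : ℝ → ℝ) (u : ℝ → Ed n → ℂ) : Prop :=
  ContDiff ℝ (⊤ : ℕ∞) (fun p : ℝ × Ed n => u p.1 p.2) ∧ SchwartzDecay u ∧
    ∀ t x, Complex.I * deriv (fun s => u s x) t =
      -(1/2) * lapC (u t) x + ((g (‖u t x‖ ^ 2) : ℝ) : ℂ) * u t x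

/-- Mass density `ρ = |u|²`. -/
def dens {n : ℕ} (u : ℝ → Ed n → ℂ) (t : ℝ) (x : Ed n) : ℝ := ‖u t x‖ ^ 2

/-- Mass current `j = Im (ū ∇u)`, `k`-th component. -/
def curr {n : ℕ} (u : ℝ → Ed n → ℂ) (k : Fin n) (t : ℝ) (x : Ed n) : ℝ :=
  ((starRingEnd ℂ) (u t x) * pd k (u t) x).im

section SpaceTime

variable {n : ℕ} {E : Type*} [NormedAddCommGroup E]

/-- An integrable weight on `ℝⁿ`. -/
def weight (x : Ed n) : ℝ := ((1 + ‖x‖) ^ (n + 1))⁻¹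

/-- Continuous functions dominated by the weight, uniformly on compact time intervals. -/
def Dominated (F : ℝ × Ed n → E) : Prop :=
  Continuous F ∧ ∀ a b : ℝ, ∃ C : ℝ, ∀ t ∈ Set.Icc a b, ∀ x : Ed n, ‖F (t, x)‖ ≤ C * weight x

/-- Continuous functions bounded in space, uniformly on compact time intervals. -/
def LocBounded (F : ℝ × Ed n → E) : Prop :=
  Continuous F ∧ ∀ a b : ℝ, ∃ C : ℝ, ∀ t ∈ Set.Icc a b, ∀ x : Ed n, ‖F (t, x)‖ ≤ C

lemma weight_pos (x : Ed n) : 0 < weight x := by unfold weight; positivity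

lemma weight_le_one (x : Ed n) : weight x ≤ 1 :=
  inv_le_one_of_one_le₀ (one_le_pow₀ (by linarith [norm_nonneg x]))

lemma integrable_weight : Integrable (weight : Ed n → ℝ) := by
  have h := integrable_one_add_norm (E := Ed n) (μ := volume) (r := ((n + 1 : ℕ) : ℝ))
    (by simp)
  refine h.congr (Eventually.of_forall fun x => ?_)
  have hx : 0 ≤ 1 + ‖x‖ := by positivity
  simp only [weight]
  rw [Real.rpow_neg hx, Real.rpow_natCast]

lemma Dominated.locBounded {F : ℝ × Ed n → E} (hF : Dominated F) : LocBounded F := by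
  refine ⟨hF.1, fun a b => ?_⟩
  obtain ⟨C, hC⟩ := hF.2 a b
  refine ⟨|C|, fun t ht x => (hC t ht x).trans ?_⟩
  calc C * weight x ≤ |C| * 1 :=
        mul_le_mul (le_abs_self C) (weight_le_one x) (weight_pos x).le (abs_nonneg C)
    _ = |C| := mul_one _

lemma Dominated.add {F G : ℝ × Ed n → E} (hF : Dominated F) (hG : Dominated G) :
    Dominated (fun p => F p + G p) := by
  refine ⟨hF.1.add hG.1, fun a b => ?_⟩
  obtain ⟨C, hC⟩ := hF.2 a b
  obtain ⟨D, hD⟩ := hG.2 a b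
  refine ⟨C + D, fun t ht x => (norm_add_le _ _).trans ?_⟩
  linarith [hC t ht x, hD t ht x]

lemma Dominated.sum {ι : Type*} (s : Finset ι) {F : ι → ℝ × Ed n → E}
    (hF : ∀ i, Dominated (F i)) : Dominated (fun p => ∑ i ∈ s, F i p) := by
  classical
  induction s using Finset.induction_on with
  | empty => exact ⟨by simpa using continuous_const, fun a b => ⟨0, by simp⟩⟩
  | insert i s hi ih => simpa [Finset.sum_insert hi] using (hF i).add ih

lemma Dominated.of_norm_le {E' : Type*} [NormedAddCommGroup E'] {F : ℝ × Ed n → E}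
    {B : ℝ × Ed n → E'} {H : ℝ × Ed n → ℝ} (hF : Dominated F) (hB : LocBounded B)
    (hH : Continuous H) (hle : ∀ p, ‖H p‖ ≤ ‖B p‖ * ‖F p‖) : Dominated H := by
  refine ⟨hH, fun a b => ?_⟩
  obtain ⟨C, hC⟩ := hF.2 a b
  obtain ⟨D, hD⟩ := hB.2 a b
  refine ⟨D * C, fun t ht x => (hle _).trans ?_⟩
  rw [mul_assoc]
  exact mul_le_mul (hD t ht x) (hC t ht x) (norm_nonneg _) ((norm_nonneg _).trans (hD t ht x))

lemma Dominated.inner {F G : ℝ × Ed n → ℂ} (hF : Dominated F) (hG : Dominated G) :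
    Dominated (fun p => inner ℝ (F p) (G p)) :=
  hG.of_norm_le hF.locBounded (hF.1.inner hG.1) fun _ => norm_inner_le_norm _ _

lemma LocBounded.mul_dominated {B F : ℝ × Ed n → ℝ} (hB : LocBounded B) (hF : Dominated F) :
    Dominated (fun p => B p * F p) :=
  hF.of_norm_le hB (hB.1.mul hF.1) fun _ => norm_mul_le _ _

lemma locBounded_const (c : ℝ) : LocBounded (fun _ : ℝ × Ed n => c) :=
  ⟨continuous_const, fun _ _ => ⟨‖c‖, fun _ _ _ => le_rfl⟩⟩

lemma Continuous.comp_locBounded {f : ℝ → ℝ} (hf : Continuous f) {B : ℝ × Ed n → ℝ}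
    (hB : LocBounded B) : LocBounded (fun p => f (B p)) := by
  refine ⟨hf.comp hB.1, fun a b => ?_⟩
  obtain ⟨C, hC⟩ := hB.2 a b
  obtain ⟨D, hD⟩ := (isCompact_Icc (a := -C) (b := C)).exists_bound_of_continuousOn hf.continuousOn
  exact ⟨D, fun t ht x => hD _ (abs_le.1 (hC t ht x))⟩

lemma Dominated.integral_comp {f : ℝ → ℝ} (hf : Continuous f) {F : ℝ × Ed n → ℝ}
    (hF : Dominated F) : Dominated (fun p => ∫ s in (0 : ℝ)..F p, f s) := by
  refine ⟨(intervalIntegral.continuous_primitive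
    (fun a b => hf.intervalIntegrable a b) 0).comp hF.1, fun a b => ?_⟩
  obtain ⟨A, hA⟩ := hF.locBounded.2 a b
  obtain ⟨C, hC⟩ := hF.2 a b
  obtain ⟨D, hD⟩ := (isCompact_Icc (a := -A) (b := A)).exists_bound_of_continuousOn hf.continuousOn
  refine ⟨D * C, fun t ht x => ?_⟩
  have hx := abs_le.1 (hA t ht x)
  have hA0 : 0 ≤ A := (norm_nonneg _).trans (hA t ht x)
  have h1 := intervalIntegral.norm_integral_le_of_norm_le_const (a := 0) (b := F (t, x))
    (f := f) (C := D) fun y hy => hD y <| by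
      rcases Set.mem_uIoc.1 hy with h | h <;> constructor <;> linarith [h.1, h.2, hx.1, hx.2]
  have hD0 : 0 ≤ D := (norm_nonneg _).trans (hD 0 ⟨by linarith, hA0⟩)
  rw [sub_zero] at h1
  calc _ ≤ D * |F (t, x)| := h1
    _ ≤ D * (C * weight x) := by gcongr; exact hC t ht x
    _ = _ := by ring

lemma Dominated.integrable {F : ℝ × Ed n → ℝ} (hF : Dominated F) (t : ℝ) :
    Integrable (fun x => F (t, x)) := by
  obtain ⟨C, hC⟩ := hF.2 t t
  exact (integrable_weight.const_mul C).mono'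
    (hF.1.comp (by fun_prop : Continuous fun x : Ed n => (t, x))).aestronglyMeasurable
    (Eventually.of_forall fun x => hC t ⟨le_rfl, le_rfl⟩ x)

variable [NormedSpace ℝ E]

/-- Directional derivative of a function on space-time along a fixed vector `v`. -/
def dirDeriv (v : ℝ × Ed n) (F : ℝ × Ed n → E) (p : ℝ × Ed n) : E := fderiv ℝ F p v

/-- The time direction. -/
def timeDir : ℝ × Ed n := (1, 0)

/-- The `k`-th spatial coordinate direction. -/
def spaceDir (k : Fin n) : ℝ × Ed n := (0, EuclideanSpace.single k 1)

/-- Smooth functions on space-time, all derivatives of which decay rapidly in space,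
uniformly on compact time intervals. -/
def SmoothDecay (F : ℝ × Ed n → E) : Prop :=
  ContDiff ℝ (⊤ : ℕ∞) F ∧ ∀ (N m : ℕ) (a b : ℝ), ∃ C : ℝ, ∀ t ∈ Set.Icc a b, ∀ x : Ed n,
    (1 + ‖x‖) ^ m * ‖iteratedFDeriv ℝ N F (t, x)‖ ≤ C

lemma ContDiff.dirDeriv {F : ℝ × Ed n → E} (hF : ContDiff ℝ (⊤ : ℕ∞) F) (v : ℝ × Ed n) :
    ContDiff ℝ (⊤ : ℕ∞) (dirDeriv v F) :=
  (hF.fderiv_right (m := (⊤ : ℕ∞)) (by simp)).clm_apply contDiff_const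

lemma dirDeriv_comm {F : ℝ × Ed n → E} (hF : ContDiff ℝ (⊤ : ℕ∞) F) (v w : ℝ × Ed n) :
    dirDeriv v (dirDeriv w F) = dirDeriv w (dirDeriv v F) := by
  ext p
  have hd : DifferentiableAt ℝ (fderiv ℝ F) p :=
    (hF.fderiv_right (m := (⊤ : ℕ∞)) (by simp)).differentiable (by simp) p
  have key : ∀ a b : ℝ × Ed n,
      dirDeriv a (dirDeriv b F) p = fderiv ℝ (fderiv ℝ F) p a b := by
    intro a b
    change fderiv ℝ (fun q => fderiv ℝ F q b) p a = _
    rw [fderiv_clm_apply hd (by fun_prop)]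
    simp
  rw [key, key]
  have hs : IsSymmSndFDerivAt ℝ F p := by
    refine hF.contDiffAt.isSymmSndFDerivAt ?_
    rw [minSmoothness_of_isRCLikeNormedField]
    exact WithTop.coe_le_coe.2 le_top
  exact hs v w

lemma SmoothDecay.dirDeriv {F : ℝ × Ed n → E} (hF : SmoothDecay F) (v : ℝ × Ed n) :
    SmoothDecay (dirDeriv v F) := by
  refine ⟨hF.1.dirDeriv v, fun N m a b => ?_⟩
  obtain ⟨C, hC⟩ := hF.2 (N + 1) m a b
  refine ⟨‖ContinuousLinearMap.apply ℝ E v‖ * C, fun t ht x => ?_⟩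
  have hs : ContDiff ℝ (⊤ : ℕ∞) (fderiv ℝ F) := hF.1.fderiv_right (by simp)
  have h1 := (ContinuousLinearMap.apply ℝ E v).norm_iteratedFDeriv_comp_left
    (hs.contDiffAt (x := (t, x))) (n := N) (by exact WithTop.coe_le_coe.2 le_top)
  rw [norm_iteratedFDeriv_fderiv] at h1
  calc _ ≤ (1 + ‖x‖) ^ m * (‖ContinuousLinearMap.apply ℝ E v‖ *
        ‖iteratedFDeriv ℝ (N + 1) F (t, x)‖) := by gcongr; exact h1
    _ = ‖ContinuousLinearMap.apply ℝ E v‖ * ((1 + ‖x‖) ^ m *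
        ‖iteratedFDeriv ℝ (N + 1) F (t, x)‖) := by ring
    _ ≤ _ := by gcongr; exact hC t ht x

lemma SmoothDecay.dominated {F : ℝ × Ed n → E} (hF : SmoothDecay F) : Dominated F := by
  refine ⟨hF.1.continuous, fun a b => ?_⟩
  obtain ⟨C, hC⟩ := hF.2 0 (n + 1) a b
  refine ⟨C, fun t ht x => ?_⟩
  have := hC t ht x
  rw [norm_iteratedFDeriv_zero] at this
  rw [weight, ← div_eq_mul_inv, le_div_iff₀ (by positivity)]
  linarith

lemma hasFDerivAt_spaceSlice {F : ℝ × Ed n → E} (hF : Differentiable ℝ F) (t : ℝ) (x : Ed n) :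
    HasFDerivAt (fun y => F (t, y))
      ((fderiv ℝ F (t, x)).comp (ContinuousLinearMap.inr ℝ ℝ (Ed n))) x :=
  (hF (t, x)).hasFDerivAt.comp x (hasFDerivAt_prodMk_right t x)

lemma hasDerivAt_timeSlice {F : ℝ × Ed n → E} (hF : Differentiable ℝ F) (t : ℝ) (x : Ed n) :
    HasDerivAt (fun s => F (s, x)) (dirDeriv timeDir F (t, x)) t := by
  have := ((hF (t, x)).hasFDerivAt.comp t (hasFDerivAt_prodMk_left t x)).hasDerivAt
  simpa [Function.comp_def, dirDeriv, timeDir] using this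

lemma pd_spaceSlice {F : ℝ × Ed n → ℂ} (hF : Differentiable ℝ F) (k : Fin n) (t : ℝ) (x : Ed n) :
    pd k (fun y => F (t, y)) x = dirDeriv (spaceDir k) F (t, x) := by
  simp [pd, (hasFDerivAt_spaceSlice hF t x).fderiv, dirDeriv, spaceDir]

lemma pdR_spaceSlice {F : ℝ × Ed n → ℝ} (hF : Differentiable ℝ F) (k : Fin n) (t : ℝ)
    (x : Ed n) : pdR k (fun y => F (t, y)) x = dirDeriv (spaceDir k) F (t, x) := by
  simp [pdR, (hasFDerivAt_spaceSlice hF t x).fderiv, dirDeriv, spaceDir]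

lemma dirDeriv_inner {A B : ℝ × Ed n → ℂ} (hA : Differentiable ℝ A) (hB : Differentiable ℝ B)
    (v p : ℝ × Ed n) : dirDeriv v (fun q => inner ℝ (A q) (B q)) p =
      inner ℝ (A p) (dirDeriv v B p) + inner ℝ (dirDeriv v A p) (B p) :=
  fderiv_inner_apply ℝ (hA p) (hB p) v

end SpaceTime

section Convolution

variable {n : ℕ}

/-- A smooth function all of whose values are bounded. -/
def BoundedContDiff (φ : Ed n → ℝ) : Prop :=
  ContDiff ℝ (⊤ : ℕ∞) φ ∧ ∃ C : ℝ, ∀ x, ‖φ x‖ ≤ C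

lemma BoundedContDiff.integrable_mul {φ : Ed n → ℝ} (hφ : BoundedContDiff φ) {f : Ed n → ℝ}
    (hf : Integrable f) (x : Ed n) : Integrable (fun y => φ (x - y) * f y) := by
  obtain ⟨C, hC⟩ := hφ.2
  exact hf.bdd_mul (c := C) (hφ.1.continuous.comp (by fun_prop)).aestronglyMeasurable
    (Eventually.of_forall fun y => hC (x - y))

lemma integral_pdR_comp_sub_mul {φ f : Ed n → ℝ} (k : Fin n) (hφ : BoundedContDiff φ)
    (hφ' : BoundedContDiff (pdR k φ)) (hf : Differentiable ℝ f) (hfi : Integrable f)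
    (hfi' : Integrable (pdR k f)) (x : Ed n) :
    ∫ y, pdR k φ (x - y) * f y = ∫ y, φ (x - y) * pdR k f y := by
  have hd : Differentiable ℝ φ := hφ.1.differentiable (by simp)
  have hder : ∀ y, fderiv ℝ (fun z => φ (x - z)) y (EuclideanSpace.single k 1) =
      -pdR k φ (x - y) := fun y => by
    have := (hd (x - y)).hasFDerivAt.comp y ((hasFDerivAt_id y).const_sub x)
    have h2 := this.fderiv
    simp only [Function.comp_def] at h2
    rw [h2]
    simp [pdR]
  have key := integral_mul_fderiv_eq_neg_fderiv_mul_of_integrable (μ := (volume : Measure (Ed n)))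
    (f := fun y => φ (x - y)) (g := f) (v := EuclideanSpace.single k (1 : ℝ))
    (by
      simp only [hder, neg_mul]
      exact (hφ'.integrable_mul hfi x).neg)
    (hφ.integrable_mul hfi' x) (hφ.integrable_mul hfi x)
    (fun y _ => (hd.comp (by fun_prop : Differentiable ℝ fun y : Ed n => x - y)) y)
    (fun y _ => hf y)
  simp only [hder, neg_mul, integral_neg, neg_neg] at key
  exact key.symm

lemma hasDerivAt_integral_comp_sub_mul {φ : Ed n → ℝ} (hφ : BoundedContDiff φ)
    {F : ℝ × Ed n → ℝ} (hF : Differentiable ℝ F) (hFd : Dominated F)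
    (hFd' : Dominated (dirDeriv timeDir F)) (t : ℝ) (x : Ed n) :
    HasDerivAt (fun s => ∫ y, φ (x - y) * F (s, y))
      (∫ y, φ (x - y) * dirDeriv timeDir F (t, y)) t := by
  obtain ⟨C, hC⟩ := hφ.2
  obtain ⟨D, hD⟩ := hFd'.2 (t - 1) (t + 1)
  refine (hasDerivAt_integral_of_dominated_loc_of_deriv_le
    (F' := fun s y => φ (x - y) * dirDeriv timeDir F (s, y))
    (bound := fun y => C * (D * weight y)) (s := Set.Icc (t - 1) (t + 1))
    (Icc_mem_nhds (by linarith) (by linarith))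
    (Eventually.of_forall fun s => (hφ.integrable_mul (hFd.integrable s) x).aestronglyMeasurable)
    (hφ.integrable_mul (hFd.integrable t) x)
    (hφ.integrable_mul (hFd'.integrable t) x).aestronglyMeasurable
    (Eventually.of_forall fun y s hs => ?_) ((integrable_weight.const_mul D).const_mul C)
    (Eventually.of_forall fun y s _ => (hasDerivAt_timeSlice hF s y).const_mul _)).2
  rw [norm_mul]
  exact mul_le_mul (hC _) (hD s hs y) (norm_nonneg _) ((norm_nonneg _).trans (hC (x - y)))

lemma boundedContDiff_pdR {h : Ed n → ℝ} (hsmooth : ContDiff ℝ (⊤ : ℕ∞) h)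
    (hbdd : ∃ C : ℝ, ∀ x, ‖iteratedFDeriv ℝ 1 h x‖ ≤ C) (k : Fin n) :
    BoundedContDiff (pdR k h) := by
  refine ⟨(hsmooth.fderiv_right (m := (⊤ : ℕ∞)) (by simp)).clm_apply contDiff_const, ?_⟩
  obtain ⟨C, hC⟩ := hbdd
  refine ⟨C, fun x => ?_⟩
  have h1 := (fderiv ℝ h x).le_opNorm (EuclideanSpace.single k (1 : ℝ))
  have h2 := hC x
  rw [norm_iteratedFDeriv_one] at h2
  simp only [PiLp.norm_single, norm_one, mul_one] at h1
  exact h1.trans h2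

lemma boundedContDiff_hess {h : Ed n → ℝ} (hsmooth : ContDiff ℝ (⊤ : ℕ∞) h)
    (hbdd : ∃ C : ℝ, ∀ x, ‖iteratedFDeriv ℝ 2 h x‖ ≤ C) (k l : Fin n) :
    BoundedContDiff (hess h k l) := by
  have hs : ContDiff ℝ (⊤ : ℕ∞) (fderiv ℝ h) := hsmooth.fderiv_right (by simp)
  refine boundedContDiff_pdR (hs.clm_apply contDiff_const) ?_ k
  obtain ⟨C, hC⟩ := hbdd
  refine ⟨‖ContinuousLinearMap.apply ℝ ℝ (EuclideanSpace.single l (1 : ℝ))‖ * C, fun x => ?_⟩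
  have h1 := (ContinuousLinearMap.apply ℝ ℝ
    (EuclideanSpace.single l (1 : ℝ))).norm_iteratedFDeriv_comp_left
    (hs.contDiffAt (x := x)) (n := 1) (by exact WithTop.coe_le_coe.2 le_top)
  rw [norm_iteratedFDeriv_fderiv] at h1
  exact h1.trans (by gcongr; exact hC x)

end Convolution

section Momentum

variable {n : ℕ}

/-- The mass density, as a function on space-time. -/
def densST (U : ℝ × Ed n → ℂ) (p : ℝ × Ed n) : ℝ := inner ℝ (U p) (U p)

/-- The mass current, as a function on space-time. -/
def currST (U : ℝ × Ed n → ℂ) (l : Fin n) (p : ℝ × Ed n) : ℝ :=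
  inner ℝ (I * U p) (dirDeriv (spaceDir l) U p)

/-- The quadratic part `Re (∂_k ū ∂_l u)` of the momentum flux, as a function on space-time. -/
def stressST (U : ℝ × Ed n → ℂ) (k l : Fin n) (p : ℝ × Ed n) : ℝ :=
  inner ℝ (dirDeriv (spaceDir k) U p) (dirDeriv (spaceDir l) U p)

/-- The diagonal part `-(1/4) Δρ + ρ g(ρ) - G(ρ)` of the momentum flux, as a function on
space-time. -/
def pressST (g G : ℝ → ℝ) (U : ℝ × Ed n → ℂ) (p : ℝ × Ed n) : ℝ :=
  -(1/4) * (∑ k, dirDeriv (spaceDir k) (dirDeriv (spaceDir k) (densST U)) p)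
    + densST U p * g (densST U p) - G (densST U p)

variable {U : ℝ × Ed n → ℂ}

lemma contDiff_densST (hU : ContDiff ℝ (⊤ : ℕ∞) U) : ContDiff ℝ (⊤ : ℕ∞) (densST U) :=
  hU.inner ℝ hU

lemma contDiff_stressST (hU : ContDiff ℝ (⊤ : ℕ∞) U) (k l : Fin n) :
    ContDiff ℝ (⊤ : ℕ∞) (stressST U k l) :=
  (hU.dirDeriv _).inner ℝ (hU.dirDeriv _)

lemma contDiff_currST (hU : ContDiff ℝ (⊤ : ℕ∞) U) (l : Fin n) :
    ContDiff ℝ (⊤ : ℕ∞) (currST U l) :=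
  (contDiff_const.mul hU).inner ℝ (hU.dirDeriv _)

lemma dirDeriv_densST (hU : ContDiff ℝ (⊤ : ℕ∞) U) (v : ℝ × Ed n) :
    dirDeriv v (densST U) = fun p => 2 * inner ℝ (U p) (dirDeriv v U p) := by
  have hd := hU.differentiable (by simp)
  ext p
  refine (dirDeriv_inner hd hd v p).trans ?_
  rw [real_inner_comm (U p)]
  ring

lemma dirDeriv_dirDeriv_densST (hU : ContDiff ℝ (⊤ : ℕ∞) U) (v w : ℝ × Ed n) :
    dirDeriv w (dirDeriv v (densST U)) = fun p => 2 * (inner ℝ (U p) (dirDeriv w (dirDeriv v U) p)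
      + inner ℝ (dirDeriv w U p) (dirDeriv v U p)) := by
  have hd := hU.differentiable (by simp)
  have hd' := (hU.dirDeriv v).differentiable (by simp)
  ext p
  rw [dirDeriv_densST hU, ← dirDeriv_inner hd hd' w p]
  exact congrArg (fun L => L w) (fderiv_const_mul ((hd.inner ℝ hd') p) (2 : ℝ))

lemma dirDeriv_dirDeriv_dirDeriv_densST (hU : ContDiff ℝ (⊤ : ℕ∞) U) (v w : ℝ × Ed n)
    (p : ℝ × Ed n) :
    dirDeriv w (dirDeriv v (dirDeriv v (densST U))) p =
      2 * (inner ℝ (U p) (dirDeriv w (dirDeriv v (dirDeriv v U)) p)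
      + inner ℝ (dirDeriv w U p) (dirDeriv v (dirDeriv v U) p)
      + 2 * inner ℝ (dirDeriv v U p) (dirDeriv w (dirDeriv v U) p)) := by
  have hd := hU.differentiable (by simp)
  have hd' := (hU.dirDeriv v).differentiable (by simp)
  have hd'' := ((hU.dirDeriv v).dirDeriv v).differentiable (by simp)
  rw [dirDeriv_dirDeriv_densST hU]
  have h1 := dirDeriv_inner hd hd'' w p
  have h2 := dirDeriv_inner hd' hd' w p
  have hsum := fderiv_const_mul (𝕜 := ℝ) (((hd.inner ℝ hd'').add (hd'.inner ℝ hd')) p) 2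
  have hadd := fderiv_add (𝕜 := ℝ) ((hd.inner ℝ hd'') p) ((hd'.inner ℝ hd') p)
  have : dirDeriv w (fun q => 2 * (inner ℝ (U q) (dirDeriv v (dirDeriv v U) q)
      + inner ℝ (dirDeriv v U q) (dirDeriv v U q))) p =
      2 * (dirDeriv w (fun q => inner ℝ (U q) (dirDeriv v (dirDeriv v U) q)) p
        + dirDeriv w (fun q => inner ℝ (dirDeriv v U q) (dirDeriv v U q)) p) := by
    refine (congrArg (fun L => L w) hsum).trans ?_
    rw [hadd]
    rfl
  rw [this, h1, h2, real_inner_comm (dirDeriv v U p)]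
  ring

lemma dominated_densST (hU : SmoothDecay U) : Dominated (densST U) :=
  hU.dominated.inner hU.dominated

lemma dominated_stressST (hU : SmoothDecay U) (k l : Fin n) : Dominated (stressST U k l) :=
  (hU.dirDeriv _).dominated.inner (hU.dirDeriv _).dominated

lemma dominated_dirDeriv_stressST (hU : SmoothDecay U) (k l : Fin n) (v : ℝ × Ed n) :
    Dominated (dirDeriv v (stressST U k l)) := by
  have hk := hU.dirDeriv (spaceDir k)
  have hl := hU.dirDeriv (spaceDir l)
  have : dirDeriv v (stressST U k l) = _ := funext fun p =>
    dirDeriv_inner (hk.1.differentiable (by simp)) (hl.1.differentiable (by simp)) v p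
  rw [this]
  exact (hk.dominated.inner (hl.dirDeriv v).dominated).add
    ((hk.dirDeriv v).dominated.inner hl.dominated)

lemma SmoothDecay.I_mul (hU : SmoothDecay U) : Dominated (fun p => I * U p) := by
  refine ⟨continuous_const.mul hU.1.continuous, fun a b => ?_⟩
  obtain ⟨C, hC⟩ := hU.dominated.2 a b
  exact ⟨C, fun t ht x => by simpa using hC t ht x⟩

lemma dominated_currST (hU : SmoothDecay U) (l : Fin n) : Dominated (currST U l) :=
  hU.I_mul.inner (hU.dirDeriv _).dominated

lemma dirDeriv_currST (hU : ContDiff ℝ (⊤ : ℕ∞) U) (l : Fin n) (v p : ℝ × Ed n) :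
    dirDeriv v (currST U l) p = inner ℝ (I * U p) (dirDeriv v (dirDeriv (spaceDir l) U) p)
      + inner ℝ (I * dirDeriv v U p) (dirDeriv (spaceDir l) U p) := by
  have hd := hU.differentiable (by simp)
  have h1 : dirDeriv v (fun q => I * U q) p = I * dirDeriv v U p := by
    simp only [dirDeriv]
    rw [fderiv_const_mul (hd p)]
    rfl
  rw [← h1]
  exact dirDeriv_inner (hd.const_mul I) ((hU.dirDeriv _).differentiable (by simp)) v p

lemma dominated_dirDeriv_currST (hU : SmoothDecay U) (l : Fin n) (v : ℝ × Ed n) :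
    Dominated (dirDeriv v (currST U l)) := by
  rw [funext (dirDeriv_currST hU.1 l v)]
  exact (hU.I_mul.inner ((hU.dirDeriv _).dirDeriv v).dominated).add
    ((hU.dirDeriv v).I_mul.inner (hU.dirDeriv _).dominated)

lemma dominated_pressST {g G : ℝ → ℝ} (hg : Continuous g)
    (hG : ∀ r : ℝ, G r = ∫ s in (0 : ℝ)..r, g s) (hU : SmoothDecay U) :
    Dominated (pressST g G U) := by
  have hρ := dominated_densST hU
  have h1 : Dominated fun p => ∑ k, dirDeriv (spaceDir k) (dirDeriv (spaceDir k) (densST U)) p :=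
    Dominated.sum _ fun k => by
      rw [dirDeriv_dirDeriv_densST hU.1]
      exact (locBounded_const 2).mul_dominated
        ((hU.dominated.inner ((hU.dirDeriv _).dirDeriv _).dominated).add
          ((hU.dirDeriv _).dominated.inner (hU.dirDeriv _).dominated))
  have h2 := (hg.comp_locBounded hρ.locBounded).mul_dominated hρ
  have h3 := (locBounded_const (-1)).mul_dominated (hρ.integral_comp hg)
  have := (((locBounded_const (-(1/4))).mul_dominated h1).add h2).add h3
  refine cast (congrArg Dominated (funext fun p => ?_)) this
  rw [pressST, hG]
  ring

lemma hasFDerivAt_pressST {g G : ℝ → ℝ} (hg : ContDiff ℝ (⊤ : ℕ∞) g)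
    (hG : ∀ r : ℝ, G r = ∫ s in (0 : ℝ)..r, g s) (hU : ContDiff ℝ (⊤ : ℕ∞) U)
    (p : ℝ × Ed n) :
    HasFDerivAt (pressST g G U)
      ((-(1/4) : ℝ) • (∑ k, fderiv ℝ (dirDeriv (spaceDir k) (dirDeriv (spaceDir k) (densST U))) p)
        + (densST U p * deriv g (densST U p)) • fderiv ℝ (densST U) p) p := by
  have hρ := contDiff_densST hU
  have hρ' := (hρ.differentiable (by simp) p).hasFDerivAt
  have h1 := HasFDerivAt.fun_sum (u := Finset.univ) fun (k : Fin n) _ =>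
    (((hρ.dirDeriv (spaceDir k)).dirDeriv (spaceDir k)).differentiable (by simp) p).hasFDerivAt
  have hg' := (hg.differentiable (by simp) (densST U p)).hasDerivAt.comp_hasFDerivAt p hρ'
  have hGd : HasDerivAt G (g (densST U p)) (densST U p) := by
    rw [funext hG]
    exact intervalIntegral.integral_hasDerivAt_right (hg.continuous.intervalIntegrable _ _)
      hg.continuous.stronglyMeasurable.stronglyMeasurableAtFilter hg.continuous.continuousAt
  refine (((h1.const_mul (-(1/4))).add (hρ'.mul hg')).sub
    (hGd.comp_hasFDerivAt p hρ')).congr_fderiv ?_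
  ext v <;>
  · simp
    ring

lemma dirDeriv_pressST {g G : ℝ → ℝ} (hg : ContDiff ℝ (⊤ : ℕ∞) g)
    (hG : ∀ r : ℝ, G r = ∫ s in (0 : ℝ)..r, g s) (hU : ContDiff ℝ (⊤ : ℕ∞) U)
    (v p : ℝ × Ed n) :
    dirDeriv v (pressST g G U) p =
      -(1/4) * (∑ k, dirDeriv v (dirDeriv (spaceDir k) (dirDeriv (spaceDir k) (densST U))) p)
        + densST U p * deriv g (densST U p) * dirDeriv v (densST U) p := by
  rw [dirDeriv, (hasFDerivAt_pressST hg hG hU p).fderiv]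
  simp [dirDeriv]

lemma dominated_dirDeriv_pressST {g G : ℝ → ℝ} (hg : ContDiff ℝ (⊤ : ℕ∞) g)
    (hG : ∀ r : ℝ, G r = ∫ s in (0 : ℝ)..r, g s) (hU : SmoothDecay U) (v : ℝ × Ed n) :
    Dominated (dirDeriv v (pressST g G U)) := by
  have hρ := dominated_densST hU
  rw [funext (dirDeriv_pressST hg hG hU.1 v)]
  have hg' : Continuous (deriv g) := hg.continuous_deriv (by simp)
  refine ((locBounded_const _).mul_dominated (Dominated.sum _ fun k => ?_)).add ?_
  · rw [funext (dirDeriv_dirDeriv_dirDeriv_densST hU.1 (spaceDir k) v)]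
    have hk := hU.dirDeriv (spaceDir k)
    exact (locBounded_const 2).mul_dominated
      (((hU.dominated.inner ((hk.dirDeriv _).dirDeriv v).dominated).add
        ((hU.dirDeriv v).dominated.inner (hk.dirDeriv _).dominated)).add
        ((locBounded_const 2).mul_dominated (hk.dominated.inner (hk.dirDeriv v).dominated)))
  · rw [dirDeriv_densST hU.1]
    simp only [mul_comm (densST U _)]
    exact ((hg'.comp_locBounded hρ.locBounded).mul_dominated hρ).locBounded.mul_dominated
      ((locBounded_const 2).mul_dominated (hU.dominated.inner (hU.dirDeriv v).dominated))

/-- Local conservation of momentum for the nonlinear Schrödinger equation. -/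
lemma dirDeriv_timeDir_currST {g G : ℝ → ℝ} (hg : ContDiff ℝ (⊤ : ℕ∞) g)
    (hG : ∀ r : ℝ, G r = ∫ s in (0 : ℝ)..r, g s) (hU : ContDiff ℝ (⊤ : ℕ∞) U)
    (heq : ∀ p, I * dirDeriv timeDir U p =
      -(1/2) * (∑ k, dirDeriv (spaceDir k) (dirDeriv (spaceDir k) U) p)
        + ((g (densST U p) : ℝ) : ℂ) * U p) (l : Fin n) (p : ℝ × Ed n) :
    -dirDeriv timeDir (currST U l) p =
      (∑ k, dirDeriv (spaceDir k) (stressST U k l) p)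
        + dirDeriv (spaceDir l) (pressST g G U) p := by
  have hd := hU.differentiable (by simp)
  have hdd : ∀ v, Differentiable ℝ (dirDeriv v U) := fun v =>
    (hU.dirDeriv v).differentiable (by simp)
  have hρ : Differentiable ℝ (densST U) := (contDiff_densST hU).differentiable (by simp)
  have heq' : I * dirDeriv (spaceDir l) (dirDeriv timeDir U) p =
      -(1/2) * (∑ k, dirDeriv (spaceDir l) (dirDeriv (spaceDir k) (dirDeriv (spaceDir k) U)) p)
        + (((deriv g (densST U p) * dirDeriv (spaceDir l) (densST U) p : ℝ) : ℂ) * U p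
        + ((g (densST U p) : ℝ) : ℂ) * dirDeriv (spaceDir l) U p) := by
    have h1 := ((hdd timeDir) p).hasFDerivAt.const_mul I
    have hs := HasFDerivAt.fun_sum (u := Finset.univ) fun (k : Fin n) _ =>
      (((hU.dirDeriv (spaceDir k)).dirDeriv (spaceDir k)).differentiable (by simp) p).hasFDerivAt
    have hg' := ((hg.differentiable (by simp) (densST U p)).hasDerivAt.comp_hasFDerivAt p
      (hρ p).hasFDerivAt)
    have hgc := (ofRealCLM.hasFDerivAt.comp p hg').mul (hd p).hasFDerivAt
    have h2 := (hs.const_mul (-(1/2) : ℂ)).add hgc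
    have h3 := h1.unique (h2.congr_of_eventuallyEq (Eventually.of_forall heq))
    have h4 := congrArg (fun L => L (spaceDir l)) h3
    simp at h4
    simp only [dirDeriv] at h4 ⊢
    rw [h4]
    push_cast
    ring
  have hI : ∀ z w : ℂ, inner ℝ (I * z) w = -inner ℝ z (I * w) := by
    intro z w
    simp [Complex.inner]
    ring
  have hstress : ∀ k, dirDeriv (spaceDir k) (stressST U k l) p =
      inner ℝ (dirDeriv (spaceDir k) U p) (dirDeriv (spaceDir l) (dirDeriv (spaceDir k) U) p)
      + inner ℝ (dirDeriv (spaceDir k) (dirDeriv (spaceDir k) U) p) (dirDeriv (spaceDir l) U p) :=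
      fun k => by
    rw [← dirDeriv_comm hU (spaceDir k) (spaceDir l)]
    exact dirDeriv_inner (hdd _) (hdd _) _ p
  have hm : ∀ (r : ℝ) (z w : ℂ), inner ℝ z ((r : ℂ) * w) = r * inner ℝ z w := fun r z w => by
    rw [← real_smul, real_inner_smul_right]
  have hm' : ∀ (r : ℝ) (z w : ℂ), inner ℝ ((r : ℂ) * z) w = r * inner ℝ z w := fun r z w => by
    rw [real_inner_comm, hm, real_inner_comm]
  have hc : (-(1/2) : ℂ) = ((-(1/2) : ℝ) : ℂ) := by push_cast; rfl
  have hsum : (∑ k, dirDeriv (spaceDir k) (stressST U k l) p)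
      + -(1/4) * ∑ k,
        dirDeriv (spaceDir l) (dirDeriv (spaceDir k) (dirDeriv (spaceDir k) (densST U))) p =
      (1/2) * (∑ k, inner ℝ (dirDeriv (spaceDir k) (dirDeriv (spaceDir k) U) p)
        (dirDeriv (spaceDir l) U p))
      - (1/2) * ∑ k, inner ℝ (U p)
        (dirDeriv (spaceDir l) (dirDeriv (spaceDir k) (dirDeriv (spaceDir k) U)) p) := by
    rw [Finset.mul_sum, Finset.mul_sum, Finset.mul_sum, ← Finset.sum_add_distrib,
      ← Finset.sum_sub_distrib]
    refine Finset.sum_congr rfl fun k _ => ?_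
    rw [hstress, dirDeriv_dirDeriv_dirDeriv_densST hU,
      real_inner_comm (dirDeriv (spaceDir k) (dirDeriv (spaceDir k) U) p) (dirDeriv (spaceDir l) U p)]
    ring
  rw [dirDeriv_currST hU, dirDeriv_comm hU timeDir, hI, heq', heq, dirDeriv_pressST hg hG hU,
    ← add_assoc (∑ k, dirDeriv (spaceDir k) (stressST U k l) p), hsum,
    inner_add_right, inner_add_right, inner_add_left, hc, hm, hm, hm, hm', hm',
    inner_sum, sum_inner]
  simp only [densST]
  ring

end Momentum

/-- Original (linear) Morawetz identity for NLS in convolution form: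
with `M₀(t,x) = -∑_k (∂_k h ⋆ j_k(t))(x)`, for all `(t,x)`
`∂_t M₀ = ∑_{k,l} (∂_k∂_l h ⋆ Re(∂_k ū ∂_l u))(t,x)
  + (Δh ⋆ (-(1/4)Δρ + ρg(ρ) - G(ρ)))(t,x)`. -/
theorem nls_linear_morawetz_identity {n : ℕ} (hn : 1 ≤ n)
    (g G : ℝ → ℝ) (hg : ContDiff ℝ (⊤ : ℕ∞) g)
    (hG : ∀ r : ℝ, G r = ∫ s in (0:ℝ)..r, g s)
    (h : Ed n → ℝ) (hsmooth : ContDiff ℝ (⊤ : ℕ∞) h) (heven : ∀ x, h (-x) = h x)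
    (hbdd : ∀ i : ℕ, 1 ≤ i → ∃ C : ℝ, ∀ x, ‖iteratedFDeriv ℝ i h x‖ ≤ C)
    (u : ℝ → Ed n → ℂ) (hu : IsNLSSolution g u) :
    ∀ (t : ℝ) (x : Ed n), HasDerivAt
      (fun s => -∑ k, ∫ y, pdR k h (x - y) * curr u k s y)
      ((∑ k, ∑ l, ∫ y, hess h k l (x - y) *
          ((starRingEnd ℂ) (pd k (u t) y) * pd l (u t) y).re)
        + ∫ y, lapR h (x - y) *
            (-(1/4) * lapR (fun z => dens u t z) y
              + dens u t y * g (dens u t y) - G (dens u t y))) t := by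
  intro t x
  obtain ⟨hUs, hdec, hNLS⟩ := hu
  set U : ℝ × Ed n → ℂ := fun p => u p.1 p.2 with hUdef
  have hU : SmoothDecay U := ⟨hUs, hdec⟩
  have hUd : Differentiable ℝ U := hUs.differentiable (by simp)
  have hpd : ∀ k s, pd k (u s) = fun y => dirDeriv (spaceDir k) U (s, y) := fun k s =>
    funext fun y => pd_spaceSlice hUd k s y
  have hdens : ∀ s, dens u s = fun y => densST U (s, y) := fun s =>
    funext fun y => (real_inner_self_eq_norm_sq (u s y)).symm
  have hlap : ∀ s y, lapC (u s) y =
      ∑ k, dirDeriv (spaceDir k) (dirDeriv (spaceDir k) U) (s, y) := fun s y => by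
    refine Finset.sum_congr rfl fun k _ => ?_
    simp only [hpd]
    exact pd_spaceSlice ((hUs.dirDeriv _).differentiable (by simp)) k s y
  have hρs := contDiff_densST hUs
  have hlapR : ∀ s y, lapR (fun z => densST U (s, z)) y =
      ∑ k, dirDeriv (spaceDir k) (dirDeriv (spaceDir k) (densST U)) (s, y) := fun s y => by
    refine Finset.sum_congr rfl fun k _ => ?_
    simp only [pdR_spaceSlice (hρs.differentiable (by simp)) k]
    exact pdR_spaceSlice ((hρs.dirDeriv _).differentiable (by simp)) k s y
  have hcurr : ∀ k s y, curr u k s y = currST U k (s, y) := fun k s y => by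
    simp only [curr, currST, hpd, hUdef, Complex.inner]
    simp
    ring
  have heq : ∀ p, I * dirDeriv timeDir U p =
      -(1/2) * (∑ k, dirDeriv (spaceDir k) (dirDeriv (spaceDir k) U) p)
        + ((g (densST U p) : ℝ) : ℂ) * U p := fun ⟨s, y⟩ => by
    rw [← hlap, ← (hasDerivAt_timeSlice hUd s y).deriv]
    have h1 : densST U (s, y) = ‖u s y‖ ^ 2 := real_inner_self_eq_norm_sq (u s y)
    rw [h1]
    exact hNLS s y
  have hh : ∀ k, BoundedContDiff (pdR k h) := boundedContDiff_pdR hsmooth (hbdd 1 le_rfl)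
  have hhess : ∀ k l, BoundedContDiff (hess h k l) :=
    boundedContDiff_hess hsmooth (hbdd 2 one_le_two)
  have hstressInt : ∀ k l, ∫ y, hess h k l (x - y) * stressST U k l (t, y) =
      ∫ y, pdR l h (x - y) * dirDeriv (spaceDir k) (stressST U k l) (t, y) := fun k l => by
    have hd := (contDiff_stressST hUs k l).differentiable (by simp)
    have h1 := integral_pdR_comp_sub_mul k (hh l) (hhess k l)
      (fun y => (hasFDerivAt_spaceSlice hd t y).differentiableAt)
      ((dominated_stressST hU k l).integrable t)
      (by
        rw [funext (pdR_spaceSlice hd k t)]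
        exact (dominated_dirDeriv_stressST hU k l _).integrable t) x
    simp only [pdR_spaceSlice hd k t] at h1
    exact h1
  have hpressInt : ∀ l, ∫ y, hess h l l (x - y) * pressST g G U (t, y) =
      ∫ y, pdR l h (x - y) * dirDeriv (spaceDir l) (pressST g G U) (t, y) := fun l => by
    have hd : Differentiable ℝ (pressST g G U) := fun p =>
      (hasFDerivAt_pressST hg hG hUs p).differentiableAt
    have h1 := integral_pdR_comp_sub_mul l (hh l) (hhess l l)
      (fun y => (hasFDerivAt_spaceSlice hd t y).differentiableAt)
      ((dominated_pressST hg.continuous hG hU).integrable t)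
      (by
        rw [funext (pdR_spaceSlice hd l t)]
        exact (dominated_dirDeriv_pressST hg hG hU _).integrable t) x
    simp only [pdR_spaceSlice hd l t] at h1
    exact h1
  have hlapInt : ∫ y, lapR h (x - y) * pressST g G U (t, y) =
      ∑ l, ∫ y, pdR l h (x - y) * dirDeriv (spaceDir l) (pressST g G U) (t, y) := by
    simp only [← hpressInt]
    rw [← integral_finsetSum _ fun l _ => (hhess l l).integrable_mul
      ((dominated_pressST hg.continuous hG hU).integrable t) x]
    simp only [lapR, hess, Finset.sum_mul]
  have hder := (HasDerivAt.fun_sum (u := Finset.univ) fun (l : Fin n) _ =>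
    hasDerivAt_integral_comp_sub_mul (hh l) ((contDiff_currST hUs l).differentiable (by simp))
      (dominated_currST hU l) (dominated_dirDeriv_currST hU l timeDir) t x).neg
  simp only [hcurr]
  refine hder.congr_deriv ?_
  have hflux : ∀ k l y, ((starRingEnd ℂ) (pd k (u t) y) * pd l (u t) y).re =
      stressST U k l (t, y) := fun k l y => by
    simp only [hpd, stressST, Complex.inner, mul_comm]
  have hpress : ∀ y, -(1/4) * lapR (fun z => dens u t z) y
      + dens u t y * g (dens u t y) - G (dens u t y) = pressST g G U (t, y) := fun y => by
    simp only [hdens, hlapR, pressST]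
  simp only [hflux, hpress, hstressInt]
  rw [hlapInt, Finset.sum_comm, ← Finset.sum_add_distrib, ← Finset.sum_neg_distrib]
  refine Finset.sum_congr rfl fun l _ => ?_
  have hint : ∀ k, Integrable
      fun y => pdR l h (x - y) * dirDeriv (spaceDir k) (stressST U k l) (t, y) := fun k =>
    (hh l).integrable_mul ((dominated_dirDeriv_stressST hU k l _).integrable t) x
  rw [← integral_neg, ← integral_finsetSum _ fun k _ => hint k,
    ← integral_add (integrable_finsetSum _ fun k _ => hint k)
      ((hh l).integrable_mul ((dominated_dirDeriv_pressST hg hG hU _).integrable t) x)]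
  refine integral_congr_ae (Eventually.of_forall fun y => ?_)
  simp only
  rw [← mul_neg, dirDeriv_timeDir_currST hg hG hUs heq l (t, y), mul_add, Finset.mul_sum]
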